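/- arXiv:0710.0834 — 2 statements merged into one kernel-verified Lean document; each statement's English description precedes it below -/
import Mathlib

section
/- Let F : U × ⋯ × U → K be an n-linear form with n ≥ 3 over a field K, and let F = F' ⊕ 0 = G' ⊕ 0 be two decompositions in which F' and G' have no zero direct summands, with corresponding decompositions U = U' ⊕ U₀ and U = V' ⊕ W₀. Then U₀ = W₀ and F' is congruent to G'. -/
section Defs

variable {K : Type*} [Field K] {n : ℕ}

/-- The restriction of a multilinear form to a submodule. -/
def formRestrict {U : Type*} [AddCommGroup U] [Module K U]
    (F : MultilinearMap K (fun _ : Fin n => U) K) (W : Submodule K U) :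
    MultilinearMap K (fun _ : Fin n => W) K :=
  F.compLinearMap fun _ => W.subtype

/-- Two multilinear forms are congruent if a single linear bijection carries one to the other. -/
def FormCongruent {U V : Type*} [AddCommGroup U] [Module K U] [AddCommGroup V] [Module K V]
    (F : MultilinearMap K (fun _ : Fin n => U) K)
    (G : MultilinearMap K (fun _ : Fin n => V) K) : Prop :=
  ∃ φ : U ≃ₗ[K] V, ∀ u : Fin n → U, F u = G fun i => φ (u i)

/-- Symmetric equivalence of multilinear forms. -/
def FormSymmEquiv {U V : Type*} [AddCommGroup U] [Module K U] [AddCommGroup V] [Module K V]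
    (F : MultilinearMap K (fun _ : Fin n => U) K)
    (G : MultilinearMap K (fun _ : Fin n => V) K) : Prop :=
  ∃ φ : Fin n → U ≃ₗ[K] V, ∀ (σ : Equiv.Perm (Fin n)) (u : Fin n → U),
    F u = G fun i => φ (σ i) (u i)

/-- `W` is a direct-sum decomposition of the underlying space for which `F` vanishes on
mixed tuples, i.e. `F = ⨁ᵢ F|Wᵢ`. -/
def IsDecompFamily {U : Type*} [AddCommGroup U] [Module K U] {ι : Type*} [DecidableEq ι]
    (F : MultilinearMap K (fun _ : Fin n => U) K) (W : ι → Submodule K U) : Prop :=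
  DirectSum.IsInternal W ∧
    ∀ (x : Fin n → U) (k l : Fin n) (i j : ι), i ≠ j → x k ∈ W i → x l ∈ W j → F x = 0

/-- A multilinear form is indecomposable if in every direct-sum decomposition one of the
two subspaces is zero. -/
def FormIndecomposable {U : Type*} [AddCommGroup U] [Module K U]
    (F : MultilinearMap K (fun _ : Fin n => U) K) : Prop :=
  ∀ W₁ W₂ : Submodule K U, IsCompl W₁ W₂ →
    (∀ (x : Fin n → U) (k l : Fin n), x k ∈ W₁ → x l ∈ W₂ → F x = 0) →
    W₁ = ⊥ ∨ W₂ = ⊥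

/-- A multilinear form has no zero direct summands if in every direct-sum decomposition the
summand that is the zero form corresponds to the zero subspace. -/
def FormNoZeroSummand {U : Type*} [AddCommGroup U] [Module K U]
    (F : MultilinearMap K (fun _ : Fin n => U) K) : Prop :=
  ∀ W₁ W₂ : Submodule K U, IsCompl W₁ W₂ →
    (∀ (x : Fin n → U) (k l : Fin n), x k ∈ W₁ → x l ∈ W₂ → F x = 0) →
    (∀ x : Fin n → U, (∀ k, x k ∈ W₂) → F x = 0) → W₂ = ⊥

/-- A linear map `τ` is `G`-selfadjoint if applying `τ` in any one argument of `G`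
gives the same value regardless of the argument chosen. -/
def FormSelfAdjoint {V : Type*} [AddCommGroup V] [Module K V]
    (G : MultilinearMap K (fun _ : Fin n => V) K) (τ : V →ₗ[K] V) : Prop :=
  ∀ (v : Fin n → V) (i j : Fin n),
    G (Function.update v i (τ (v i))) = G (Function.update v j (τ (v j)))

end Defs

section Radical

variable {K : Type*} [Field K] {n : ℕ} {U : Type*} [AddCommGroup U] [Module K U]

/-- The radical of a multilinear form: the vectors which make it vanish whenever they are put
in any of its arguments. -/
def formRadical (F : MultilinearMap K (fun _ : Fin n => U) K) : Submodule K U where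
  carrier := {u | ∀ (x : Fin n → U) (k : Fin n), F (Function.update x k u) = 0}
  add_mem' ha hb x k := by rw [F.map_update_add, ha x k, hb x k, add_zero]
  zero_mem' x k := F.map_update_zero x k
  smul_mem' c u hu x k := by rw [F.map_update_smul, hu x k, smul_zero]

theorem form_eq_zero_of_mem_formRadical {F : MultilinearMap K (fun _ : Fin n => U) K}
    {x : Fin n → U} {k : Fin n} (hx : x k ∈ formRadical F) : F x = 0 := by
  simpa using hx x k

/-- In a decomposition `F = F' ⊕ 0`, the form only depends on the components in the first
subspace. -/
theorem form_projection_eq {F : MultilinearMap K (fun _ : Fin n => U) K} {U' U₀ : Submodule K U}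
    (hU : IsCompl U' U₀)
    (hmix : ∀ (x : Fin n → U) (k l : Fin n), x k ∈ U' → x l ∈ U₀ → F x = 0)
    (h0 : ∀ x : Fin n → U, (∀ k, x k ∈ U₀) → F x = 0) (x : Fin n → U) :
    F (fun i => U'.projection U₀ hU (x i)) = F x := by
  set a : Fin n → U := fun i => U'.projection U₀ hU (x i) with ha
  set b : Fin n → U := fun i => U₀.projection U' hU.symm (x i) with hb
  have hx : x = a + b :=
    funext fun i => (Submodule.projection_add_projection_eq_self hU (x i)).symm
  have hb_mem (i : Fin n) : b i ∈ U₀ := Submodule.projection_apply_mem hU.symm _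
  have ha_mem (i : Fin n) : a i ∈ U' := Submodule.projection_apply_mem hU _
  conv_rhs => rw [hx]
  rw [F.map_add_univ, Finset.sum_eq_single Finset.univ, Finset.piecewise_univ]
  · intro s _ hs
    obtain ⟨l, hl⟩ : ∃ l, l ∉ s := by
      by_contra! h
      exact hs (Finset.eq_univ_iff_forall.2 h)
    rcases s.eq_empty_or_nonempty with rfl | ⟨k, hk⟩
    · exact h0 _ fun k => by simpa using hb_mem k
    · refine hmix _ k l ?_ ?_
      · simpa [hk] using ha_mem k
      · simpa [hl] using hb_mem l
  · simp

/-- In a decomposition `F = F' ⊕ 0` in which `F'` has no zero direct summands, the zero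
subspace is the radical of `F`. -/
theorem eq_formRadical {F : MultilinearMap K (fun _ : Fin n => U) K} {U' U₀ : Submodule K U}
    (hn : 0 < n) (hU : IsCompl U' U₀)
    (hmix : ∀ (x : Fin n → U) (k l : Fin n), x k ∈ U' → x l ∈ U₀ → F x = 0)
    (h0 : ∀ x : Fin n → U, (∀ k, x k ∈ U₀) → F x = 0)
    (hnz : FormNoZeroSummand (formRestrict F U')) : U₀ = formRadical F := by
  have hle : U₀ ≤ formRadical F := fun u hu x k => by
    rw [← form_projection_eq hU hmix h0]
    exact F.map_coord_zero k (by simpa using hu)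
  have hbot : (formRadical F).comap U'.subtype = ⊥ := by
    obtain ⟨C, hC⟩ := ((formRadical F).comap U'.subtype).exists_isCompl
    exact hnz C _ hC.symm
      (fun x _ l _ hl =>
        form_eq_zero_of_mem_formRadical (F := F) (x := fun i => (x i : U)) (k := l) hl)
      fun x hx =>
        form_eq_zero_of_mem_formRadical (F := F) (x := fun i => (x i : U)) (k := ⟨0, hn⟩) (hx _)
  have hdisj : Disjoint (formRadical F) U' := by
    rw [disjoint_comm]
    exact Submodule.disjoint_iff_comap_eq_bot.2 hbot
  refine le_antisymm hle fun u hu => ?_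
  have hmem : U'.projection U₀ hU u ∈ formRadical F := by
    have := (formRadical F).sub_mem hu (hle (Submodule.sub_projection_mem hU u))
    simpa using this
  rw [← Submodule.projection_apply_eq_zero_iff hU]
  exact Submodule.disjoint_def.1 hdisj _ hmem (Submodule.projection_apply_mem hU u)

end Radical

/-- Theorem 4(a): if `F = F' ⊕ 0 = G' ⊕ 0` are two decompositions (`n ≥ 3`) in which `F'`
and `G'` have no zero direct summands, then the zero subspaces coincide and `F'` is
congruent to `G'`. -/
theorem stmt_11 {K : Type*} [Field K] {n : ℕ} (hn : 3 ≤ n)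
    {U : Type*} [AddCommGroup U] [Module K U] [FiniteDimensional K U]
    (F : MultilinearMap K (fun _ : Fin n => U) K)
    (U' U₀ V' W₀ : Submodule K U)
    -- F = F' ⊕ 0 with respect to U = U' ⊕ U₀
    (hU : IsCompl U' U₀)
    (hUmix : ∀ (x : Fin n → U) (k l : Fin n), x k ∈ U' → x l ∈ U₀ → F x = 0)
    (hU0 : ∀ x : Fin n → U, (∀ k, x k ∈ U₀) → F x = 0)
    (hUnz : FormNoZeroSummand (formRestrict F U'))
    -- F = G' ⊕ 0 with respect to U = V' ⊕ W₀
    (hV : IsCompl V' W₀)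
    (hVmix : ∀ (x : Fin n → U) (k l : Fin n), x k ∈ V' → x l ∈ W₀ → F x = 0)
    (hV0 : ∀ x : Fin n → U, (∀ k, x k ∈ W₀) → F x = 0)
    (hVnz : FormNoZeroSummand (formRestrict F V')) :
    U₀ = W₀ ∧ FormCongruent (formRestrict F U') (formRestrict F V') := by
  have hpos : 0 < n := by lia
  obtain rfl : U₀ = W₀ :=
    (eq_formRadical hpos hU hUmix hU0 hUnz).trans (eq_formRadical hpos hV hVmix hV0 hVnz).symm
  refine ⟨rfl, (U₀.quotientEquivOfIsCompl U' hU.symm).symm.trans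
    (U₀.quotientEquivOfIsCompl V' hV.symm), fun u => ?_⟩
  exact (form_projection_eq hV hVmix hV0 fun i => (u i : U)).symm
end

section
/- Let A and B be n×n complex matrices such that the pairs (A, Aᵀ) and (B, Bᵀ) are equivalent, i.e., there exist nonsingular complex matrices R and S with A = R B S and Aᵀ = R Bᵀ S. Then A and B are congruent: there exists a nonsingular complex matrix P with A = Pᵀ B P. -/
open Matrix

open Polynomial in
/-- Modulo a monic complex polynomial not vanishing at `0`, the variable is a square. -/
lemma exists_dvd_sq_sub_X (p : ℂ[X]) (hp : p.Monic) (h0 : p.eval 0 ≠ 0) :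
    ∃ f : ℂ[X], p ∣ f ^ 2 - X := by
  choose s hs using fun z : ℂ => IsAlgClosed.exists_pow_nat_eq z (n := 2) two_pos
  set q : ℂ[X] := Lagrange.interpolate p.roots.toFinset id s with hq
  have hqs : ∀ a ∈ p.roots, q.eval a = s a := fun a ha =>
    Lagrange.eval_interpolate_at_node s (v := id) Function.injective_id.injOn
      (Multiset.mem_toFinset.2 ha)
  have hnil : p ∣ (q ^ 2 - X) ^ p.roots.card := by
    conv_lhs => rw [(IsAlgClosed.splits p).eq_prod_roots_of_monic hp]
    have := Multiset.prod_dvd_prod_of_dvd (S := p.roots) (fun a => X - C a)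
      (fun _ => q ^ 2 - X) fun a ha => by
        rw [dvd_iff_isRoot]
        simp [hqs a ha, hs]
    simpa using this
  have hx : IsUnit (AdjoinRoot.root p) := by
    have : IsCoprime X p := by
      rw [(irreducible_X (R := ℂ)).coprime_iff_not_dvd, X_dvd_iff, coeff_zero_eq_eval_zero]
      exact h0
    obtain ⟨u, v, huv⟩ := this
    refine IsUnit.of_mul_eq_one (AdjoinRoot.mk p u) ?_
    have := congrArg (AdjoinRoot.mk p) huv
    simpa [mul_comm] using this
  have hn : IsNilpotent (AdjoinRoot.mk p q ^ 2 - AdjoinRoot.root p) := by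
    refine ⟨p.roots.card, ?_⟩
    have := AdjoinRoot.mk_eq_zero.2 hnil
    simpa using this
  have hqu : IsUnit (AdjoinRoot.mk p q) := by
    have := hn.isUnit_add_left_of_commute hx (Commute.all _ _)
    rw [add_sub_cancel] at this
    exact (isUnit_pow_iff two_ne_zero).1 this
  have h2 : IsUnit (2 : AdjoinRoot p) := by
    rw [← map_ofNat (AdjoinRoot.of p) 2]
    exact (IsUnit.mk0 (2 : ℂ) two_ne_zero).map _
  obtain ⟨y, ⟨-, hy⟩, -⟩ := Polynomial.existsUnique_nilpotent_sub_and_aeval_eq_zero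
    (P := X ^ 2 - C (AdjoinRoot.root p)) (x := AdjoinRoot.mk p q)
    (by simpa using hn) (by simpa [one_add_one_eq_two] using h2.mul hqu)
  obtain ⟨f, rfl⟩ := AdjoinRoot.mk_surjective y
  refine ⟨f, AdjoinRoot.mk_eq_zero.1 ?_⟩
  simpa using hy

/-- An invertible complex matrix has a square root that is a polynomial in it. -/
lemma Matrix.exists_aeval_sq_eq {n : Type*} [Fintype n] [DecidableEq n] (M : Matrix n n ℂ)
    (hM : IsUnit M.det) : ∃ f : Polynomial ℂ, Polynomial.aeval M f ^ 2 = M := by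
  obtain ⟨f, g, hf⟩ := exists_dvd_sq_sub_X M.charpoly M.charpoly_monic (by
    rw [← Polynomial.coeff_zero_eq_eval_zero]
    intro h
    rw [det_eq_sign_charpoly_coeff, h, mul_zero] at hM
    exact not_isUnit_zero hM)
  refine ⟨f, sub_eq_zero.1 ?_⟩
  simpa [aeval_self_charpoly] using congrArg (Polynomial.aeval M) hf

/-- If `B` intertwines `M` and `Mᵀ`, it intertwines `f(M)` and `f(M)ᵀ`. -/
lemma Matrix.mul_aeval_eq_transpose_aeval_mul {n K : Type*} [Fintype n] [DecidableEq n]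
    [CommRing K] {B M : Matrix n n K} (h : B * M = Mᵀ * B) (f : Polynomial K) :
    B * Polynomial.aeval M f = (Polynomial.aeval M f)ᵀ * B := by
  induction f using Polynomial.induction_on' with
  | add p q hp hq => simp [mul_add, add_mul, hp, hq]
  | monomial m a =>
    have hm : SemiconjBy B (M ^ m) (Mᵀ ^ m) := SemiconjBy.pow_right h m
    simp [Polynomial.aeval_monomial, Algebra.algebraMap_eq_smul_one, transpose_pow, hm.eq]

/-- If the pairs `(A, Aᵀ)` and `(B, Bᵀ)` of complex matrices are equivalent, i.e.
`A = R * B * S` and `Aᵀ = R * Bᵀ * S` for some nonsingular `R` and `S`, then `A` and `B`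
are congruent: `A = Pᵀ * B * P` for some nonsingular `P`. -/
theorem stmt_15 {k : ℕ} (A B R S : Matrix (Fin k) (Fin k) ℂ)
    (hR : IsUnit R.det) (hS : IsUnit S.det)
    (hA : A = R * B * S) (hAT : Aᵀ = R * Bᵀ * S) :
    ∃ P : Matrix (Fin k) (Fin k) ℂ, IsUnit P.det ∧ A = Pᵀ * B * P := by
  have hA' : A = Sᵀ * B * Rᵀ := by
    simpa [mul_assoc] using congrArg transpose hAT
  have hRT : IsUnit Rᵀ.det := by rwa [det_transpose]
  set M := S * Rᵀ⁻¹ with hM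
  have hMR : M * Rᵀ = S := nonsing_inv_mul_cancel_right _ _ hRT
  have hMdet : IsUnit M.det := by
    rw [hM, det_mul]
    exact hS.mul (isUnit_nonsing_inv_det _ hRT)
  have hBM : B * M = Mᵀ * B := by
    have hRM : R * Mᵀ = Sᵀ := by simpa using congrArg transpose hMR
    have h : R * (B * M) * Rᵀ = R * (Mᵀ * B) * Rᵀ := by
      rw [← mul_assoc R Mᵀ, hRM, ← hA', hA, ← hMR]
      simp only [mul_assoc]
    have h' := (((isUnit_iff_isUnit_det _).2 hRT).mul_left_inj).1 h
    exact (((isUnit_iff_isUnit_det _).2 hR).mul_right_inj).1 h'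
  obtain ⟨f, hf⟩ := M.exists_aeval_sq_eq hMdet
  have hN := mul_aeval_eq_transpose_aeval_mul hBM f
  set N := Polynomial.aeval M f
  have hNdet : IsUnit N.det := by
    rw [← hf, det_pow] at hMdet
    exact (isUnit_pow_iff two_ne_zero).1 hMdet
  refine ⟨N * Rᵀ, by rw [det_mul]; exact hNdet.mul hRT, ?_⟩
  calc A = R * (B * N) * N * Rᵀ := by rw [hA, ← hMR, ← hf]; simp only [sq, mul_assoc]
    _ = (N * Rᵀ)ᵀ * B * (N * Rᵀ) := by
      rw [hN, transpose_mul, transpose_transpose]; simp only [mul_assoc]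
end
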